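/- Let p, p̃ be real-rooted real polynomials of degree exactly n with p ⪯ p̃, and let q be a real polynomial of degree exactly n all of whose roots are real and nonnegative. Then p ⊠_n q ⪯ p̃ ⊠_n q. -/

import Mathlib

open Polynomial

/-- Generalized hypergeometric polynomial in standard normalization:
`₍i+1₎𝓕_j(-n, a; b; x) = Σ_{k=0}^n (-n)_k (a)_k (b+k)_{n-k} x^k / k!`. -/
noncomputable def hyp (n : ℕ) {i j : ℕ} (a : Fin i → ℝ) (b : Fin j → ℝ) : Polynomial ℝ :=
  ∑ k ∈ Finset.range (n + 1),
    Polynomial.C (((ascPochhammer ℝ k).eval (-(n : ℝ)) *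
        (∏ s, (ascPochhammer ℝ k).eval (a s)) *
        (∏ s, (ascPochhammer ℝ (n - k)).eval (b s + (k : ℝ)))) / (Nat.factorial k : ℝ)) *
      Polynomial.X ^ k

/-- The coefficient `e_k(p)` in the representation `p(x) = Σ_{k=0}^n (-1)^k e_k(p) x^{n-k}`. -/
def eCoeff (n k : ℕ) (p : Polynomial ℝ) : ℝ := (-1 : ℝ) ^ k * p.coeff (n - k)

/-- Finite free multiplicative convolution `p ⊠_n q`. -/
noncomputable def ffMul (n : ℕ) (p q : Polynomial ℝ) : Polynomial ℝ :=
  ∑ k ∈ Finset.range (n + 1),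
    Polynomial.C ((-1 : ℝ) ^ k * ((n.choose k : ℝ))⁻¹ * eCoeff n k p * eCoeff n k q) *
      Polynomial.X ^ (n - k)

/-- Finite free additive convolution `p ⊞_n q`. -/
noncomputable def ffAdd (n : ℕ) (p q : Polynomial ℝ) : Polynomial ℝ :=
  ∑ k ∈ Finset.range (n + 1),
    Polynomial.C ((-1 : ℝ) ^ k *
      ∑ l ∈ Finset.range (k + 1),
        (((n - l).factorial : ℝ) * ((n - (k - l)).factorial : ℝ)) /
            ((n.factorial : ℝ) * ((n - k).factorial : ℝ)) *
          eCoeff n l p * eCoeff n (k - l) q) *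
      Polynomial.X ^ (n - k)

/-- A real polynomial is real-rooted if all of its complex roots are real, i.e. the number of
real roots counted with multiplicity equals the degree. -/
def RealRooted (p : Polynomial ℝ) : Prop := p.roots.card = p.natDegree

/-- The real roots of `p`, with multiplicity, sorted in increasing order. -/
noncomputable def sroots (p : Polynomial ℝ) : List ℝ := p.roots.sort (· ≤ ·)

/-- `p ⪯ q`: `p` and `q` are real-rooted of degree `n` and
`λ_1(p) ≤ λ_1(q) ≤ λ_2(p) ≤ … ≤ λ_n(p) ≤ λ_n(q)` (roots in increasing order). -/
noncomputable def Interlaces (n : ℕ) (p q : Polynomial ℝ) : Prop :=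
  RealRooted p ∧ RealRooted q ∧ p.natDegree = n ∧ q.natDegree = n ∧
  (∀ k, k < n → (sroots p).getD k 0 ≤ (sroots q).getD k 0) ∧
  (∀ k, k + 1 < n → (sroots q).getD k 0 ≤ (sroots p).getD (k + 1) 0)

/-- `p ≺ q`: strict interlacing. -/
noncomputable def StrictInterlaces (n : ℕ) (p q : Polynomial ℝ) : Prop :=
  RealRooted p ∧ RealRooted q ∧ p.natDegree = n ∧ q.natDegree = n ∧
  (∀ k, k < n → (sroots p).getD k 0 < (sroots q).getD k 0) ∧
  (∀ k, k + 1 < n → (sroots q).getD k 0 < (sroots p).getD (k + 1) 0)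

/-- The mesh (minimal distance between roots) of a real-rooted polynomial with `n` roots. -/
noncomputable def mesh (n : ℕ) (p : Polynomial ℝ) : ℝ :=
  sInf {d : ℝ | ∃ k l : ℕ, k < l ∧ l < n ∧
    d = |(sroots p).getD k 0 - (sroots p).getD l 0|}

/-- The logarithmic mesh (minimal ratio between consecutive decreasingly ordered roots) of a
polynomial with `n` positive roots. -/
noncomputable def lmesh (n : ℕ) (p : Polynomial ℝ) : ℝ :=
  sInf {d : ℝ | ∃ k : ℕ, k + 1 < n ∧
    d = (sroots p).getD (k + 1) 0 / (sroots p).getD k 0}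

/-- Generalized Laguerre polynomial `L_n^{(α)}`. -/
noncomputable def Laguerre (n : ℕ) (α : ℝ) : Polynomial ℝ :=
  ∑ k ∈ Finset.range (n + 1),
    Polynomial.C ((descPochhammer ℝ (n - k)).eval ((n : ℝ) + α) /
        ((k.factorial : ℝ) * ((n - k).factorial : ℝ)) * (-1 : ℝ) ^ k) *
      Polynomial.X ^ k

noncomputable def ev (n : ℕ) (f q : ℂ[X]) (x : ℂ) : ℂ :=
  ∑ j ∈ Finset.range (n + 1), (-1) ^ (n - j) * ((n.choose j : ℂ))⁻¹ * f.coeff j * q.coeff j * x ^ j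

noncomputable def polar (m : ℕ) (f : ℂ[X]) (a x : ℂ) : ℂ[X] :=
  C x * derivative f + C a * (C ((m : ℂ) + 1) * f - X * derivative f)

lemma polar_coeff (m : ℕ) (f : ℂ[X]) (a x : ℂ) (j : ℕ) :
    (polar m f a x).coeff j = x * (f.coeff (j+1) * (j+1)) + a * ((m + 1 - j) * f.coeff j) := by
  unfold polar
  rw [coeff_add, coeff_C_mul, coeff_C_mul, coeff_sub, coeff_C_mul, coeff_derivative]
  cases j with
  | zero => simp
  | succ j => rw [coeff_X_mul, coeff_derivative]; push_cast; ring

lemma ev_rec (m : ℕ) (f r : ℂ[X]) (a x : ℂ) (hr : r.natDegree ≤ m) :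
    ((m : ℂ) + 1) * ev (m+1) f ((X - C a) * r) x = ev m (polar m f a x) r x := by
  have hc1 : ∀ j ≤ m, ((m : ℂ) + 1) * (((m+1).choose (j+1) : ℕ) : ℂ)⁻¹
      = (j + 1) * ((m.choose j : ℕ) : ℂ)⁻¹ := by
    intro j hj
    have h := Nat.add_one_mul_choose_eq m j
    have h1 : ((m.choose j : ℕ) : ℂ) ≠ 0 := by exact_mod_cast (Nat.choose_pos hj).ne'
    have h2 : (((m+1).choose (j+1) : ℕ) : ℂ) ≠ 0 := by
      exact_mod_cast (Nat.choose_pos (by omega)).ne'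
    have h' : ((m : ℂ) + 1) * (m.choose j : ℕ) = ((m+1).choose (j+1) : ℕ) * (j + 1) := by
      exact_mod_cast h
    field_simp
    linear_combination h'
  have hc2 : ∀ j ≤ m, ((m : ℂ) + 1) * (((m+1).choose j : ℕ) : ℂ)⁻¹
      = (m + 1 - j) * ((m.choose j : ℕ) : ℂ)⁻¹ := by
    intro j hj
    have h := Nat.choose_mul_succ_eq m j
    have h1 : ((m.choose j : ℕ) : ℂ) ≠ 0 := by exact_mod_cast (Nat.choose_pos hj).ne'
    have h2 : (((m+1).choose j : ℕ) : ℂ) ≠ 0 := by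
      exact_mod_cast (Nat.choose_pos (by omega)).ne'
    have h' : ((m.choose j : ℕ) : ℂ) * (m + 1) = ((m+1).choose j : ℕ) * (m + 1 - j) := by
      have : ((m + 1 - j : ℕ) : ℂ) = m + 1 - j := by
        rw [Nat.cast_sub (by omega)]; push_cast; ring
      rw [← this]; exact_mod_cast h
    field_simp
    linear_combination h'
  have hX : ∀ j, ((X - C a) * r).coeff j = (X * r).coeff j - a * r.coeff j := by
    intro j; rw [sub_mul, coeff_sub, coeff_C_mul]
  unfold ev
  simp only [hX]
  simp only [mul_sub, sub_mul, Finset.sum_sub_distrib]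
  rw [Finset.sum_range_succ' (fun j : ℕ => (-1 : ℂ) ^ (m + 1 - j) * ((((m+1).choose j : ℕ)) : ℂ)⁻¹ * f.coeff j * (X * r : ℂ[X]).coeff j * x ^ j),
    Finset.sum_range_succ (fun j : ℕ => (-1 : ℂ) ^ (m + 1 - j) * ((((m+1).choose j : ℕ)) : ℂ)⁻¹ * f.coeff j * (a * r.coeff j) * x ^ j) (m+1)]
  rw [coeff_eq_zero_of_natDegree_lt (show r.natDegree < m + 1 by omega)]
  simp only [coeff_X_mul, mul_coeff_zero, coeff_X_zero, zero_mul, mul_zero, add_zero]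
  rw [Finset.mul_sum, Finset.mul_sum, ← Finset.sum_sub_distrib]
  refine Finset.sum_congr rfl fun j hj => ?_
  have hj : j ≤ m := by simpa [Nat.lt_succ_iff] using hj
  rw [polar_coeff]
  have e1 : m + 1 - (j + 1) = m - j := by omega
  have e2 : m + 1 - j = (m - j) + 1 := by omega
  rw [e1, e2, pow_succ]
  linear_combination ((-1) ^ (m-j) * f.coeff (j+1) * r.coeff j * x ^ (j+1)) * hc1 j hj
    + ((-1) ^ (m-j) * f.coeff j * a * r.coeff j * x ^ j) * hc2 j hj

lemma disc_sum (c : ℝ) (s : Multiset ℂ) (h : ∀ w ∈ s, ‖w - Complex.I * c‖ ≤ c) :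
    ‖s.sum - s.card * (Complex.I * c)‖ ≤ s.card * c := by
  induction s using Multiset.induction_on with
  | empty => simp
  | cons w s ih =>
    have h1 := h w (by simp)
    have h2 := ih (fun w hw => h w (by simp [hw]))
    have h3 := norm_add_le (w - Complex.I * c) (s.sum - s.card * (Complex.I * c))
    rw [Multiset.sum_cons, Multiset.card_cons]
    have : w + s.sum - ((s.card + 1 : ℕ) : ℂ) * (Complex.I * c)
      = (w - Complex.I * c) + (s.sum - s.card * (Complex.I * c)) := by push_cast; ring
    rw [this]; push_cast; linarith

lemma im_sum_pos (s : Multiset ℂ) (hs : s ≠ 0) (h : ∀ w ∈ s, 0 < w.im) : 0 < s.sum.im := by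
  have key : ∀ s : Multiset ℂ, (∀ w ∈ s, 0 < w.im) → 0 ≤ s.sum.im := by
    intro s h
    induction s using Multiset.induction_on with
    | empty => simp
    | cons w s ih =>
      have h1 := h w (by simp)
      have h2 := ih (fun w hw => h w (by simp [hw]))
      simp; linarith
  obtain ⟨w, hw⟩ := Multiset.exists_mem_of_ne_zero hs
  obtain ⟨t, rfl⟩ := Multiset.exists_cons_of_mem hw
  have h1 := h w (by simp)
  have h2 := key t (fun w hw => h w (by simp [hw]))
  simp; linarith

lemma im_sum_nonneg (s : Multiset ℂ) (h : ∀ w ∈ s, 0 ≤ w.im) : 0 ≤ s.sum.im := by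
  induction s using Multiset.induction_on with
  | empty => simp
  | cons w s ih =>
    have h1 := h w (by simp)
    have h2 := ih (fun w hw => h w (by simp [hw]))
    simp; linarith

lemma polar_ne (m : ℕ) (f : ℂ[X]) (hf : f.natDegree = m + 1) (hL : ∀ y : ℂ, y.im < 0 → f.eval y ≠ 0)
    (a : ℝ) (ha : 0 ≤ a) (x : ℂ) (hx : x.im < 0) (y : ℂ) (hy : y.im < 0) :
    (polar m f a x).eval y ≠ 0 := by
  have hsp : f.Splits := IsAlgClosed.splits f
  have hder := Polynomial.Splits.eval_derivative_div_eval_of_ne_zero hsp (hL y hy)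
  have hcard : f.roots.card = m + 1 := by rw [← hf, ← hsp.natDegree_eq_card_roots]
  set S := (f.roots.map fun z => 1 / (y - z)).sum with hS
  have hf0 : f ≠ 0 := by rintro rfl; simp at hf
  have hr : ∀ z ∈ f.roots, 0 ≤ z.im := by
    intro z hz
    by_contra hneg
    exact hL z (not_le.mp hneg) ((mem_roots hf0).1 hz)
  set c : ℝ := 1 / (2 * (-y.im)) with hc
  have hcpos : 0 < c := by rw [hc]; apply one_div_pos.2; linarith
  have hw : ∀ z : ℂ, 0 ≤ z.im → ‖1 / (y - z) - Complex.I * c‖ ≤ c ∧ 0 < (1 / (y - z)).im := by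
    intro z hz
    have hpos : 0 < Complex.normSq (y - z) := by
      apply Complex.normSq_pos.2
      intro h0
      have := congrArg Complex.im h0
      simp at this; linarith
    have him : (1 / (y - z)).im = (z.im - y.im) / Complex.normSq (y - z) := by
      rw [one_div, Complex.inv_im]; simp
    have hre : (1 / (y - z)).re = (y.re - z.re) / Complex.normSq (y - z) := by
      rw [one_div, Complex.inv_re]; simp
    have hns : Complex.normSq (y - z) = (y.re - z.re)^2 + (y.im - z.im)^2 := by
      rw [Complex.normSq_apply]; simp; ring
    constructor
    · rw [← sq_le_sq₀ (norm_nonneg _) hcpos.le, ← Complex.normSq_eq_norm_sq, Complex.normSq_apply]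
      simp only [Complex.sub_re, Complex.sub_im, Complex.mul_re, Complex.mul_im, Complex.I_re, Complex.I_im, Complex.ofReal_re, Complex.ofReal_im]
      rw [him, hre]
      set N := Complex.normSq (y - z)
      have h1 : 2 * c * (z.im - y.im) ≥ 1 := by
        have h5 : c * (-y.im) * 2 = 1 := by rw [hc]; field_simp [hy.ne]
        nlinarith [mul_nonneg hcpos.le hz]
      have h2 : ((y.re - z.re) / N)^2 + ((z.im - y.im)/N)^2 = 1 / N := by
        field_simp; rw [hns]; ring
      have h3 : 1 / N ≤ 2 * c * ((z.im - y.im) / N) := by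
        rw [← mul_div_assoc]; gcongr
      nlinarith
    · rw [him]; apply div_pos _ hpos; linarith
  have hS1 : 0 < S.im := by
    apply im_sum_pos
    · intro h0
      have := congrArg Multiset.card h0
      simp [hcard] at this
    · intro w hw'
      obtain ⟨z, hz, rfl⟩ := Multiset.mem_map.1 hw'
      exact (hw z (hr z hz)).2
  have hS2 := disc_sum c (f.roots.map fun z => 1 / (y - z)) (by
      intro w hw'
      obtain ⟨z, hz, rfl⟩ := Multiset.mem_map.1 hw'
      exact (hw z (hr z hz)).1)
  rw [Multiset.card_map, hcard, ← hS] at hS2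
  have hN : (0:ℝ) < (m:ℝ) + 1 := by positivity
  push_cast at hS2
  rw [← sq_le_sq₀ (norm_nonneg _) (by positivity), ← Complex.normSq_eq_norm_sq, Complex.normSq_apply] at hS2
  simp at hS2
  intro h0
  have hd : (derivative f).eval y = S * f.eval y := by
    rw [← hder]; field_simp [hL y hy]
  have h1 : (x - a * y) * S + a * (m + 1) = 0 := by
    have : ((x - a * y) * S + a * (m + 1)) * f.eval y = 0 := by
      rw [← h0]; simp [polar, hd]; ring
    exact (mul_eq_zero.1 this).resolve_right (hL y hy)
  have hre := congrArg Complex.re h1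
  have him := congrArg Complex.im h1
  simp at hre him
  set p := S.re
  set q := S.im
  have h5 : c * (-y.im) * 2 = 1 := by rw [hc]; field_simp [hy.ne]
  -- p² + q² ≤ 2 c N q
  have h6 : p^2 + q^2 ≤ 2 * c * (m+1) * q := by nlinarith
  have h7 : (p^2+q^2) * (-y.im) ≤ (m+1) * q := by
    have : (p^2+q^2) * (-y.im) ≤ (2 * c * (m+1) * q) * (-y.im) := by
      apply mul_le_mul_of_nonneg_right h6; linarith
    have e : (2 * c * (m+1) * q) * (-y.im) = (m+1) * q := by linear_combination ((m+1) * q) * h5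
    linarith
  -- im (x - a y) * |S|² = a N q
  have h8 : (x.im - a * y.im) * (p^2+q^2) = a * (m+1) * q := by
    linear_combination p * him - q * hre
  have h9 : 0 < p^2 + q^2 := by positivity
  have h10 : a * ((p^2+q^2) * (-y.im)) ≤ a * ((m+1) * q) := mul_le_mul_of_nonneg_left h7 ha
  nlinarith

lemma polar_deg (m : ℕ) (f : ℂ[X]) (hf : f.natDegree = m + 1) (hL : ∀ y : ℂ, y.im < 0 → f.eval y ≠ 0)
    (a : ℝ) (ha : 0 ≤ a) (x : ℂ) (hx : x.im < 0)  :
    (polar m f a x).natDegree = m := by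
  have hsp : f.Splits := IsAlgClosed.splits f
  have hf0 : f ≠ 0 := by rintro rfl; simp at hf
  have hr : ∀ z ∈ f.roots, 0 ≤ z.im := by
    intro z hz
    by_contra hneg
    exact hL z (not_le.mp hneg) ((mem_roots hf0).1 hz)
  have hle : (polar m f a x).natDegree ≤ m := by
    rw [natDegree_le_iff_coeff_eq_zero]
    intro j hj
    rw [polar_coeff, coeff_eq_zero_of_natDegree_lt (show f.natDegree < j + 1 by omega)]
    rcases eq_or_ne j (m+1) with rfl | h
    · push_cast; ring
    · rw [coeff_eq_zero_of_natDegree_lt (show f.natDegree < j by omega)]; ring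
  apply natDegree_eq_of_le_of_coeff_ne_zero hle
  rw [polar_coeff]
  have h1 := Polynomial.Splits.nextCoeff_eq_neg_sum_roots_mul_leadingCoeff hsp
  rw [nextCoeff_of_natDegree_pos (by omega), hf] at h1
  simp at h1
  have h2 : f.coeff (m+1) = f.leadingCoeff := by rw [leadingCoeff, hf]
  rw [h1, h2]
  have h3 := im_sum_nonneg _ hr
  intro h0
  have h4 : x * (m+1) - a * f.roots.sum = 0 := by
    apply (mul_eq_zero.1 (_ : (x * (m+1) - a * f.roots.sum) * f.leadingCoeff = 0)).resolve_right
      (leadingCoeff_ne_zero.2 hf0)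
    linear_combination h0
  have := congrArg Complex.im h4
  simp at this
  have : 0 ≤ a * f.roots.sum.im := mul_nonneg ha h3
  have : x.im * (m+1) < 0 := mul_neg_of_neg_of_pos hx (by positivity)
  linarith

lemma core (s : Multiset ℝ) : ∀ (f : ℂ[X]), (∀ a ∈ s, 0 ≤ a) → f.natDegree = s.card →
    (∀ y : ℂ, y.im < 0 → f.eval y ≠ 0) → ∀ x : ℂ, x.im < 0 →
    ev s.card f (s.map fun a : ℝ => X - C (a : ℂ)).prod x ≠ 0 := by
  induction s using Multiset.induction_on with
  | empty =>
    intro f _ hf hL x hx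
    have := hL x hx
    obtain ⟨b, rfl⟩ := natDegree_eq_zero.1 (show f.natDegree = 0 by simpa using hf)
    simpa [ev] using this
  | cons a s ih =>
    intro f hs hf hL x hx
    rw [Multiset.card_cons] at hf ⊢
    have ha := hs a (by simp)
    have h1 := ih (polar s.card f a x) (fun b hb => hs b (by simp [hb]))
      (polar_deg _ f hf hL a ha x hx) (polar_ne _ f hf hL a ha x hx) x hx
    rw [Multiset.map_cons, Multiset.prod_cons]
    rw [← ev_rec _ _ _ _ _ (by
      have := natDegree_multiset_prod_le (s.map fun a : ℝ => X - C (a : ℂ))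
      simpa using this)] at h1
    exact right_ne_zero_of_mul h1

lemma one_sub_I (u : ℝ) : (1 : ℂ) - Complex.I * u
    = (√(1 + u^2) : ℝ) * Complex.exp (-(Real.arctan u : ℝ) * Complex.I) := by
  have h : √(1 + u^2) ≠ 0 := by positivity
  rw [← Complex.ofReal_neg, Complex.exp_mul_I, ← Complex.ofReal_cos, ← Complex.ofReal_sin, Real.cos_neg, Real.sin_neg,
    Real.cos_arctan, Real.sin_arctan]
  apply Complex.ext
  · simp; field_simp
  · simp; field_simp

lemma prod_polar (n : ℕ) (u : ℕ → ℝ) : ∃ R : ℝ, 0 < R ∧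
    ∏ k ∈ Finset.range n, ((1 : ℂ) - Complex.I * u k)
      = R * Complex.exp (-((∑ k ∈ Finset.range n, Real.arctan (u k) : ℝ)) * Complex.I) := by
  refine ⟨∏ k ∈ Finset.range n, √(1 + (u k)^2), Finset.prod_pos fun k _ => by positivity, ?_⟩
  push_cast
  rw [← Finset.sum_neg_distrib, Finset.sum_mul, Complex.exp_sum, ← Finset.prod_mul_distrib]
  refine Finset.prod_congr rfl fun k _ => ?_
  rw [one_sub_I]; push_cast; rfl

noncomputable def DD (n : ℕ) (a b : ℕ → ℝ) (t s : ℝ) : ℝ :=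
  ∑ k ∈ Finset.range n, (Real.arctan (s * (a k - t)) - Real.arctan (s * (b k - t)))

/-- at `x = t - i/s`, the quotient of products is `R e^{iD}` -/
lemma quot_polar (n : ℕ) (a b : ℕ → ℝ) (t s : ℝ) (hs : 0 < s) :
    ∃ R : ℝ, 0 < R ∧ ∏ k ∈ Finset.range n, ((t : ℂ) - Complex.I / s - b k)
      = R * Complex.exp (DD n a b t s * Complex.I) *
        ∏ k ∈ Finset.range n, ((t : ℂ) - Complex.I / s - a k) := by
  have hs' : (s : ℂ) ≠ 0 := by exact_mod_cast hs.ne'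
  have h : ∀ c : ℕ → ℝ, ∏ k ∈ Finset.range n, ((t : ℂ) - Complex.I / s - c k)
      = (-Complex.I / s) ^ n * ∏ k ∈ Finset.range n, ((1 : ℂ) - Complex.I * (s * (c k - t) : ℝ)) := by
    intro c
    rw [← Finset.card_range n, ← Finset.prod_const, Finset.card_range, ← Finset.prod_mul_distrib]
    refine Finset.prod_congr rfl fun k _ => ?_
    push_cast
    field_simp
    linear_combination (- (s:ℂ) * (c k - t)) * Complex.I_sq
  obtain ⟨R1, h1, e1⟩ := prod_polar n (fun k => s * (a k - t))
  obtain ⟨R2, h2, e2⟩ := prod_polar n (fun k => s * (b k - t))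
  refine ⟨R2 / R1, by positivity, ?_⟩
  rw [h, h, e1, e2]
  have h1' : (R1 : ℂ) ≠ 0 := by exact_mod_cast h1.ne'
  have : Complex.exp (-((∑ k ∈ Finset.range n, Real.arctan (s * (b k - t)) : ℝ)) * Complex.I)
     = Complex.exp (DD n a b t s * Complex.I) * Complex.exp (-((∑ k ∈ Finset.range n, Real.arctan (s * (a k - t)) : ℝ)) * Complex.I) := by
    rw [← Complex.exp_add]
    congr 1
    unfold DD
    rw [Finset.sum_sub_distrib]
    push_cast; ring
  rw [this]
  push_cast
  field_simp

lemma im_polar (R D : ℝ) : ((R : ℂ) * Complex.exp (D * Complex.I)).im = R * Real.sin D := by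
  rw [Complex.im_ofReal_mul, Complex.exp_ofReal_mul_I_im]

lemma forward (n : ℕ) (a b : ℕ → ℝ) (h1 : ∀ k, k < n → a k ≤ b k) (h2 : ∀ k, k + 1 < n → b k ≤ a (k+1))
    (x : ℂ) (hx : x.im < 0) (w : ℂ) (hw : 0 < w.im) :
    ∏ k ∈ Finset.range n, (x - b k) - w * ∏ k ∈ Finset.range n, (x - a k) ≠ 0 := by
  intro h0
  set s : ℝ := 1 / (-x.im) with hsdef
  have hs : 0 < s := by apply one_div_pos.2; linarith
  obtain ⟨R, hR, e⟩ := quot_polar n a b x.re s hs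
  have hxe : (x.re : ℂ) - Complex.I / s = x := by
    rw [hsdef]
    have hy : (x.im : ℂ) ≠ 0 := by exact_mod_cast hx.ne
    nth_rewrite 3 [← Complex.re_add_im x]
    push_cast
    field_simp
    try ring
  rw [hxe] at e
  have hne : ∏ k ∈ Finset.range n, (x - a k) ≠ 0 := by
    rw [Finset.prod_ne_zero_iff]
    intro k _ h
    have := congrArg Complex.im h
    simp at this; linarith
  have hwe : w = R * Complex.exp (DD n a b x.re s * Complex.I) := by
    apply mul_right_cancel₀ hne
    rw [← e]; linear_combination -h0
  have him : w.im = R * Real.sin (DD n a b x.re s) := by rw [hwe, im_polar]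
  have hD0 : DD n a b x.re s ≤ 0 := by
    apply Finset.sum_nonpos
    intro k hk
    have := Real.arctan_strictMono.monotone (show s * (a k - x.re) ≤ s * (b k - x.re) by
      have := h1 k (Finset.mem_range.1 hk)
      gcongr)
    linarith
  have hD1 : -Real.pi ≤ DD n a b x.re s := by
    unfold DD
    cases n with
    | zero => simp [Real.pi_pos.le]
    | succ n =>
      rw [Finset.sum_sub_distrib, Finset.sum_range_succ', Finset.sum_range_succ (fun k => Real.arctan (s * (b k - x.re)))]
      have : ∑ k ∈ Finset.range n, Real.arctan (s * (b k - x.re)) ≤ ∑ k ∈ Finset.range n, Real.arctan (s * (a (k+1) - x.re)) := by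
        apply Finset.sum_le_sum
        intro k hk
        apply Real.arctan_strictMono.monotone
        have := h2 k (by have := Finset.mem_range.1 hk; omega)
        gcongr
      have := Real.arctan_lt_pi_div_two (s * (b n - x.re))
      have := Real.neg_pi_div_two_lt_arctan (s * (a 0 - x.re))
      linarith
  have := Real.sin_nonpos_of_nonpos_of_neg_pi_le hD0 hD1
  nlinarith

lemma tendsto_arctan_sign (c : ℝ) : Filter.Tendsto (fun s : ℝ => Real.arctan (s * c)) Filter.atTop
    (nhds (Real.pi / 2 * Real.sign c)) := by
  rcases lt_trichotomy c 0 with h | h | h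
  · rw [Real.sign_of_neg h, mul_neg_one]
    exact (Real.tendsto_arctan_atBot.mono_right nhdsWithin_le_nhds).comp
      (Filter.tendsto_id.atTop_mul_const_of_neg h)
  · subst h; simp
  · rw [Real.sign_of_pos h, mul_one]
    exact (Real.tendsto_arctan_atTop.mono_right nhdsWithin_le_nhds).comp
      (Filter.tendsto_id.atTop_mul_const h)

lemma sign_ge (c : ℝ) : -1 ≤ Real.sign c := by
  rcases Real.sign_apply_eq c with h | h | h <;> rw [h] <;> norm_num
lemma sign_le (c : ℝ) : Real.sign c ≤ 1 := by
  rcases Real.sign_apply_eq c with h | h | h <;> rw [h] <;> norm_num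

lemma sign_bounds (n : ℕ) (a b : ℕ → ℝ)
    (H : ∀ x : ℂ, x.im < 0 → ∀ w : ℂ, 0 < w.im →
      ∏ k ∈ Finset.range n, (x - b k) - w * ∏ k ∈ Finset.range n, (x - a k) ≠ 0) (t : ℝ) :
    -2 ≤ ∑ k ∈ Finset.range n, (Real.sign (a k - t) - Real.sign (b k - t)) ∧
    ∑ k ∈ Finset.range n, (Real.sign (a k - t) - Real.sign (b k - t)) ≤ 0 := by
  have hsin : ∀ s, 0 < s → Real.sin (DD n a b t s) ≤ 0 := by
    intro s hs
    obtain ⟨R, hR, e⟩ := quot_polar n a b t s hs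
    by_contra hneg
    refine H (t - Complex.I / s) ?_ _ ?_ (sub_eq_zero.2 e)
    · simp; exact hs
    · rw [im_polar]; exact mul_pos hR (not_le.1 hneg)
  have hcont : Continuous (DD n a b t) := by
    unfold DD
    fun_prop
  have hD0 : DD n a b t 0 = 0 := by simp [DD]
  have hpi := Real.pi_pos
  have hup : ∀ s, 0 ≤ s → DD n a b t s ≤ 0 := by
    intro s hs
    by_contra hneg
    have hneg := not_le.1 hneg
    obtain ⟨s', ⟨hs1, _⟩, h⟩ := intermediate_value_Icc hs hcont.continuousOn
      (show min (DD n a b t s) (Real.pi / 2) ∈ Set.Icc (DD n a b t 0) (DD n a b t s) by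
        rw [hD0]; exact ⟨le_min hneg.le (by positivity), min_le_left _ _⟩)
    have hm : 0 < min (DD n a b t s) (Real.pi / 2) := lt_min hneg (by positivity)
    have hs' : 0 < s' := by
      rcases hs1.eq_or_lt with h' | h'
      · rw [← h', hD0] at h; linarith
      · exact h'
    have := hsin s' hs'
    rw [h] at this
    have := Real.sin_pos_of_pos_of_lt_pi hm (by have := min_le_right (DD n a b t s) (Real.pi / 2); linarith)
    linarith
  have hlo : ∀ s, 0 ≤ s → -Real.pi ≤ DD n a b t s := by
    intro s hs
    by_contra hneg
    have hneg := not_le.1 hneg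
    set v := max (DD n a b t s) (-(3 * Real.pi / 2))
    have hv1 : v < -Real.pi := max_lt hneg (by linarith)
    have hv2 : -(3 * Real.pi / 2) ≤ v := le_max_right _ _
    obtain ⟨s', ⟨hs1, _⟩, h⟩ := intermediate_value_Icc' hs hcont.continuousOn
      (show v ∈ Set.Icc (DD n a b t s) (DD n a b t 0) by
        rw [hD0]; exact ⟨le_max_left _ _, by linarith⟩)
    have hs' : 0 < s' := by
      rcases hs1.eq_or_lt with h' | h'
      · rw [← h', hD0] at h; linarith
      · exact h'
    have := hsin s' hs'
    rw [h] at this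
    have := Real.sin_pos_of_pos_of_lt_pi (x := v + 2 * Real.pi) (by linarith) (by linarith)
    rw [Real.sin_add_two_pi] at this
    linarith
  have hlim : Filter.Tendsto (DD n a b t) Filter.atTop
      (nhds (∑ k ∈ Finset.range n, (Real.pi / 2 * Real.sign (a k - t) - Real.pi / 2 * Real.sign (b k - t)))) := by
    unfold DD
    exact tendsto_finsetSum _ fun k _ => (tendsto_arctan_sign _).sub (tendsto_arctan_sign _)
  have l1 := le_of_tendsto hlim (Filter.eventually_atTop.2 ⟨0, fun s hs => hup s hs⟩)
  have l2 := ge_of_tendsto hlim (Filter.eventually_atTop.2 ⟨0, fun s hs => hlo s hs⟩)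
  simp only [← mul_sub] at l1 l2
  rw [← Finset.mul_sum] at l1 l2
  constructor <;> nlinarith

lemma backward (n : ℕ) (a b : ℕ → ℝ) (ha : ∀ i j, i ≤ j → j < n → a i ≤ a j)
    (hb : ∀ i j, i ≤ j → j < n → b i ≤ b j)
    (H : ∀ x : ℂ, x.im < 0 → ∀ w : ℂ, 0 < w.im →
      ∏ k ∈ Finset.range n, (x - b k) - w * ∏ k ∈ Finset.range n, (x - a k) ≠ 0) :
    (∀ k, k < n → a k ≤ b k) ∧ (∀ k, k + 1 < n → b k ≤ a (k+1)) := by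
  constructor
  · intro k hk
    by_contra hlt
    obtain ⟨t, ht1, ht2⟩ := exists_between (not_le.1 hlt)
    have h := (sign_bounds n a b H t).2
    have h3 : ∀ j ∈ Finset.range n, 0 ≤ Real.sign (a j - t) - Real.sign (b j - t) := by
      intro j hj
      have hj := Finset.mem_range.1 hj
      rcases le_total j k with h | h
      · rw [Real.sign_of_neg (show b j - t < 0 by have := hb j k h hk; linarith)]
        have := sign_ge (a j - t); linarith
      · rw [Real.sign_of_pos (show 0 < a j - t by have := ha k j h hj; linarith)]
        have := sign_le (b j - t); linarith
    have h4 := Finset.single_le_sum h3 (Finset.mem_range.2 hk)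
    rw [Real.sign_of_neg (show b k - t < 0 by linarith), Real.sign_of_pos (show 0 < a k - t by linarith)] at h4
    linarith
  · intro k hk
    by_contra hlt
    obtain ⟨t, ht1, ht2⟩ := exists_between (not_le.1 hlt)
    have h := (sign_bounds n a b H t).1
    have h3 : ∀ j ∈ Finset.range n, Real.sign (a j - t) - Real.sign (b j - t) ≤
        (if j = k then (-2:ℝ) else 0) + (if j = k + 1 then (-2:ℝ) else 0) := by
      intro j hj
      have hj := Finset.mem_range.1 hj
      have ga := sign_le (a j - t)
      have gb := sign_ge (b j - t)
      have A : j ≤ k + 1 → Real.sign (a j - t) = -1 := fun h =>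
        Real.sign_of_neg (by have := ha j (k+1) h hk; linarith)
      have B : k ≤ j → Real.sign (b j - t) = 1 := fun h =>
        Real.sign_of_pos (by have := hb k j h hj; linarith)
      rcases lt_trichotomy j k with h | h | h
      · rw [A (by omega), if_neg (by omega), if_neg (by omega)]; linarith
      · rw [A (by omega), B (by omega), if_pos (by omega), if_neg (by omega)]; norm_num
      · rcases eq_or_ne j (k+1) with h' | h'
        · rw [A (by omega), B (by omega), if_neg (by omega), if_pos (by omega)]; norm_num
        · rw [B (by omega), if_neg (by omega), if_neg (by omega)]; linarith
    have h4 := Finset.sum_le_sum h3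
    rw [Finset.sum_add_distrib, Finset.sum_ite_eq', Finset.sum_ite_eq',
      if_pos (Finset.mem_range.2 (by omega)), if_pos (Finset.mem_range.2 (by omega))] at h4
    linarith

lemma list_prod_getD (g : ℝ → ℂ) (l : List ℝ) :
    (l.map g).prod = ∏ k ∈ Finset.range l.length, g (l.getD k 0) := by
  induction l with
  | nil => simp
  | cons a l ih =>
    rw [List.map_cons, List.prod_cons, ih, List.length_cons, Finset.prod_range_succ', mul_comm]
    simp

lemma map_eq_prod (p : ℝ[X]) (hp : RealRooted p) :
    p.map Complex.ofRealHom
      = C (p.leadingCoeff : ℂ) * (p.roots.map fun a : ℝ => X - C (a : ℂ)).prod := by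
  conv_lhs => rw [← C_leadingCoeff_mul_prod_multiset_X_sub_C hp]
  rw [Polynomial.map_mul, Polynomial.map_multiset_prod, Multiset.map_map]
  simp

lemma eval_eq_prod (n : ℕ) (p : ℝ[X]) (hp : RealRooted p) (hd : p.natDegree = n) (x : ℂ) :
    (p.map Complex.ofRealHom).eval x
      = p.leadingCoeff * ∏ k ∈ Finset.range n, (x - ((sroots p).getD k 0 : ℝ)) := by
  have hl : (sroots p).length = n := by
    rw [sroots, Multiset.length_sort, ← hd]; exact hp
  rw [map_eq_prod p hp, eval_mul, eval_C, eval_multiset_prod, Multiset.map_map]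
  congr 1
  have : p.roots = (sroots p : Multiset ℝ) := (Multiset.sort_eq p.roots (· ≤ ·)).symm
  rw [this, Multiset.map_coe, Multiset.prod_coe, list_prod_getD, hl]
  simp

lemma sroots_mono (n : ℕ) (p : ℝ[X]) (hp : RealRooted p) (hd : p.natDegree = n) (i j : ℕ)
    (hij : i ≤ j) (hj : j < n) : (sroots p).getD i 0 ≤ (sroots p).getD j 0 := by
  have hl : (sroots p).length = n := by
    rw [sroots, Multiset.length_sort, ← hd]; exact hp
  rw [List.getD_eq_getElem _ _ (by omega), List.getD_eq_getElem _ _ (by omega)]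
  rcases hij.eq_or_lt with h | h
  · subst h; exact le_rfl
  · exact List.pairwise_iff_getElem.1 (Multiset.pairwise_sort p.roots (· ≤ ·)) i j _ _ h

lemma eval_ffMul (n : ℕ) (p q : ℝ[X]) (x : ℂ) :
    ((ffMul n p q).map Complex.ofRealHom).eval x
      = ev n (p.map Complex.ofRealHom) (q.map Complex.ofRealHom) x := by
  unfold ffMul ev eCoeff
  rw [← Finset.sum_flip, Polynomial.map_sum, eval_finsetSum]
  refine Finset.sum_congr rfl fun k hk => ?_
  have hk : k ≤ n := by simpa [Nat.lt_succ_iff] using hk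
  have e : n - (n - k) = k := by omega
  simp only [coeff_map, Nat.choose_symm hk, e]
  have h2 : ((-1 : ℂ) ^ (n - k)) * (-1) ^ (n - k) = 1 := by rw [← mul_pow]; simp
  simp
  left
  linear_combination ((-1) ^ (n - k) * ((n.choose k : ℂ))⁻¹ * (p.coeff k : ℂ) * (q.coeff k : ℂ)) * h2

lemma ffMul_coeff_n (n : ℕ) (p q : ℝ[X]) : (ffMul n p q).coeff n = p.coeff n * q.coeff n := by
  unfold ffMul eCoeff
  rw [finsetSum_coeff, Finset.sum_eq_single 0]
  · rw [coeff_C_mul_X_pow]; simp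
  · intro k hk h0
    have hk : k ≤ n := by simpa [Nat.lt_succ_iff] using hk
    rw [coeff_C_mul_X_pow, if_neg (by omega)]
  · simp

lemma ffMul_deg (n : ℕ) (p q : ℝ[X]) (hp : p.coeff n ≠ 0) (hq : q.coeff n ≠ 0) :
    (ffMul n p q).natDegree = n := by
  apply natDegree_eq_of_le_of_coeff_ne_zero
  · apply natDegree_sum_le_of_forall_le
    intro k _
    exact (natDegree_C_mul_X_pow_le _ _).trans (by omega)
  · rw [ffMul_coeff_n]; exact mul_ne_zero hp hq

lemma core' (n : ℕ) (q : ℝ[X]) (hq : RealRooted q) (hqd : q.natDegree = n) (hq0 : ∀ x ∈ q.roots, 0 ≤ x)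
    (hqn : q ≠ 0) (f : ℂ[X]) (hf : f.natDegree = n) (hL : ∀ y : ℂ, y.im < 0 → f.eval y ≠ 0)
    (x : ℂ) (hx : x.im < 0) : ev n f (q.map Complex.ofRealHom) x ≠ 0 := by
  have hc : q.roots.card = n := by rw [← hqd]; exact hq
  have h := core q.roots f hq0 (by rw [hf, hc]) hL x hx
  rw [hc] at h
  have e : ev n f (q.map Complex.ofRealHom) x = (q.leadingCoeff : ℂ) *
      ev n f (q.roots.map fun a : ℝ => X - C (a : ℂ)).prod x := by
    rw [map_eq_prod q hq]
    unfold ev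
    rw [Finset.mul_sum]
    refine Finset.sum_congr rfl fun k _ => ?_
    rw [coeff_C_mul]; ring
  rw [e]
  exact mul_ne_zero (by exact_mod_cast leadingCoeff_ne_zero.2 hqn) h

lemma conj_eval (p : ℝ[X]) (x : ℂ) : (p.map Complex.ofRealHom).eval (starRingEnd ℂ x)
    = starRingEnd ℂ ((p.map Complex.ofRealHom).eval x) := by
  rw [eval_map, eval_map, hom_eval₂]
  congr 1
  ext r; simp

lemma ffMul_rr (n : ℕ) (p q : ℝ[X]) (hq : RealRooted q) (hqd : q.natDegree = n)
    (hq0 : ∀ x ∈ q.roots, 0 ≤ x) (hqn : q ≠ 0) (hp : RealRooted p) (hpd : p.natDegree = n)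
    (hpn : p ≠ 0) : RealRooted (ffMul n p q) := by
  have hL : ∀ x : ℂ, x.im < 0 → ((ffMul n p q).map Complex.ofRealHom).eval x ≠ 0 := by
    intro x hx
    rw [eval_ffMul]
    refine core' n q hq hqd hq0 hqn _ (by rw [natDegree_map, hpd]) ?_ x hx
    intro y hy
    rw [eval_eq_prod n p hp hpd]
    refine mul_ne_zero (by exact_mod_cast leadingCoeff_ne_zero.2 hpn) ?_
    rw [Finset.prod_ne_zero_iff]
    intro k _ h
    have := congrArg Complex.im h
    simp at this; linarith
  have hs : (ffMul n p q).Splits := by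
    apply Splits.of_splits_map Complex.ofRealHom (IsAlgClosed.splits _)
    intro z hz
    have hz0 := (mem_roots'.1 hz).2
    refine ⟨z.re, ?_⟩
    apply Complex.ext
    · simp
    · simp
      rcases lt_trichotomy z.im 0 with h | h | h
      · exact absurd hz0 (hL z h)
      · exact h.symm
      · exfalso
        apply hL (starRingEnd ℂ z) (by simpa using h)
        rw [conj_eval, hz0]; simp
  exact splits_iff_card_roots.1 hs

/-- preservation of interlacing by the multiplicative finite free convolution
with a polynomial with nonnegative real roots. -/
theorem ffMul_preserves_interlacing (n : ℕ) (p pt q : Polynomial ℝ)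
    (hq : RealRooted q) (hqd : q.natDegree = n) (hq0 : ∀ x ∈ q.roots, 0 ≤ x)
    (h : Interlaces n p pt) :
    Interlaces n (ffMul n p q) (ffMul n pt q) := by
  obtain ⟨hp, hpt, hpd, hptd, h1, h2⟩ := h
  rcases Nat.eq_zero_or_pos n with hn | hn
  · subst hn
    have hdeg : ∀ r : ℝ[X], (ffMul 0 r q).natDegree = 0 := by
      intro r; simp [ffMul, ← C_mul, -map_mul]
    have hrr : ∀ r : ℝ[X], RealRooted (ffMul 0 r q) := by
      intro r
      unfold RealRooted
      have := card_roots' (ffMul 0 r q)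
      have := hdeg r
      omega
    exact ⟨hrr p, hrr pt, hdeg p, hdeg pt, fun k hk => absurd hk (by omega),
      fun k hk => absurd hk (by omega)⟩
  have hne : ∀ r : ℝ[X], r.natDegree = n → r ≠ 0 := by
    rintro r hr rfl
    simp at hr; omega
  have hqn := hne q hqd
  have hpn := hne p hpd
  have hptn := hne pt hptd
  have lc : ∀ r : ℝ[X], r.natDegree = n → r.coeff n = r.leadingCoeff := by
    intro r hr; rw [leadingCoeff, hr]
  have lc0 : ∀ r : ℝ[X], r.natDegree = n → r.coeff n ≠ 0 := by
    intro r hr; rw [lc r hr]; exact leadingCoeff_ne_zero.2 (hne r hr)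
  have hPd := ffMul_deg n p q (lc0 p hpd) (lc0 q hqd)
  have hPtd := ffMul_deg n pt q (lc0 pt hptd) (lc0 q hqd)
  have hP := ffMul_rr n p q hq hqd hq0 hqn hp hpd hpn
  have hPt := ffMul_rr n pt q hq hqd hq0 hqn hpt hptd hptn
  have key := backward n (fun k => (sroots (ffMul n p q)).getD k 0)
    (fun k => (sroots (ffMul n pt q)).getD k 0) (sroots_mono n _ hP hPd) (sroots_mono n _ hPt hPtd)
    (by
      intro x hx w hw h0
      have cp : (p.coeff n : ℂ) ≠ 0 := by exact_mod_cast lc0 p hpd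
      have cpt : (pt.coeff n : ℂ) ≠ 0 := by exact_mod_cast lc0 pt hptd
      set f : ℂ[X] := C (p.coeff n : ℂ) * pt.map Complex.ofRealHom
        - C (w * pt.coeff n) * p.map Complex.ofRealHom with hf
      have fd : f.natDegree = n := by
        apply natDegree_eq_of_le_of_coeff_ne_zero
        · rw [hf]
          refine (natDegree_sub_le _ _).trans (max_le ?_ ?_)
          · exact (natDegree_C_mul_le _ _).trans (by rw [natDegree_map, hptd])
          · exact (natDegree_C_mul_le _ _).trans (by rw [natDegree_map, hpd])
        · rw [hf, coeff_sub, coeff_C_mul, coeff_C_mul, coeff_map, coeff_map]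
          have : (p.coeff n : ℂ) * (pt.coeff n) * (1 - w) ≠ 0 := by
            refine mul_ne_zero (mul_ne_zero cp cpt) ?_
            intro h
            have := congrArg Complex.im h
            simp at this; linarith
          intro h
          apply this
          simp at h
          linear_combination h
      have fL : ∀ y : ℂ, y.im < 0 → f.eval y ≠ 0 := by
        intro y hy h
        rw [hf, eval_sub, eval_mul, eval_mul, eval_C, eval_C, eval_eq_prod n p hp hpd,
          eval_eq_prod n pt hpt hptd, ← lc p hpd, ← lc pt hptd] at h
        have := forward n _ _ h1 h2 y hy w hw
        apply mul_ne_zero (mul_ne_zero cp cpt) this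
        linear_combination h
      have := core' n q hq hqd hq0 hqn f fd fL x hx
      apply this
      have e : ev n f (q.map Complex.ofRealHom) x
          = p.coeff n * ev n (pt.map Complex.ofRealHom) (q.map Complex.ofRealHom) x
           - w * pt.coeff n * ev n (p.map Complex.ofRealHom) (q.map Complex.ofRealHom) x := by
        unfold ev
        rw [Finset.mul_sum, Finset.mul_sum, ← Finset.sum_sub_distrib]
        refine Finset.sum_congr rfl fun k _ => ?_
        rw [hf, coeff_sub, coeff_C_mul, coeff_C_mul]; ring
      rw [e, ← eval_ffMul, ← eval_ffMul, eval_eq_prod n _ hP hPd, eval_eq_prod n _ hPt hPtd,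
        ← lc _ hPd, ← lc _ hPtd, ffMul_coeff_n, ffMul_coeff_n]
      push_cast
      linear_combination (p.coeff n * pt.coeff n * q.coeff n : ℂ) * h0)
  exact ⟨hP, hPt, hPd, hPtd, key.1, key.2⟩
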